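/- Let A be a C*-algebra, E a right Hilbert C*-module over A with A-valued inner product ⟨·,·⟩, and π : A → B(h) a *-representation of A on a Hilbert space h. Then for every n and all ξ_1, ..., ξ_n ∈ E and w_1, ..., w_n ∈ h, the sum Σ_{i,j=1}^n ⟨w_i, π(⟨ξ_i, ξ_j⟩) w_j⟩_h is a nonnegative real number. Consequently, the sesquilinear form on the free vector space spanned by the symbols (ξ,w), ξ ∈ E, w ∈ h, determined by ⟨(ξ,w), (ξ',w')⟩ := ⟨w, π(⟨ξ,ξ'⟩) w'⟩_h, is a positive semidefinite semi-inner product. -/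

import Mathlib

open scoped InnerProductSpace
open ComplexOrder

/-- A right Hilbert C*-module structure over a C*-algebra `A` on a complex Banach space `E`:
a right `A`-action `smulA` and an `A`-valued inner product `innerA`, `A`-linear in the second
variable, with `⟨x,y⟩* = ⟨y,x⟩`, `⟨x,x⟩ ≥ 0`, definiteness, and `‖x‖ = ‖⟨x,x⟩‖^{1/2}`. -/
structure HilbertCStarModule (A : Type*) (E : Type*) [NonUnitalCStarAlgebra A]
    [NormedAddCommGroup E] [Module ℂ E] where
  smulA : E → A → E
  innerA : E → E → A
  smulA_add_left : ∀ (x y : E) (a : A), smulA (x + y) a = smulA x a + smulA y a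
  smulA_add_right : ∀ (x : E) (a b : A), smulA x (a + b) = smulA x a + smulA x b
  smulA_mul : ∀ (x : E) (a b : A), smulA (smulA x a) b = smulA x (a * b)
  smulA_smul_left : ∀ (z : ℂ) (x : E) (a : A), smulA (z • x) a = z • smulA x a
  smulA_smul_right : ∀ (z : ℂ) (x : E) (a : A), smulA x (z • a) = z • smulA x a
  innerA_add_right : ∀ x y z : E, innerA x (y + z) = innerA x y + innerA x z
  innerA_smulA_right : ∀ (x y : E) (a : A), innerA x (smulA y a) = innerA x y * a
  innerA_smul_right : ∀ (z : ℂ) (x y : E), innerA x (z • y) = z • innerA x y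
  innerA_star : ∀ x y : E, star (innerA x y) = innerA y x
  innerA_self_nonneg : ∀ x : E, ∃ b : A, innerA x x = star b * b
  innerA_self_eq_zero : ∀ x : E, innerA x x = 0 → x = 0
  norm_eq : ∀ x : E, ‖x‖ ^ 2 = ‖innerA x x‖

/-- A self-adjoint element `T` can be compressed by a self-adjoint element to `-(S⋆ S)`, where `S`
vanishes only if `T` is positive. -/
theorem IsSelfAdjoint.exists_conjugate_eq_neg_star_mul_self {B : Type*} [NonUnitalCStarAlgebra B]
    {T : B} (hT : IsSelfAdjoint T) :
    ∃ N S : B, star N = N ∧ N * T * N = -(star S * S) ∧ (S = 0 → ∃ b, T = star b * b) := by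
  let _ : PartialOrder B := CStarAlgebra.spectralOrder B
  have _ : StarOrderedRing B := CStarAlgebra.spectralOrderedRing B
  obtain ⟨r, hr⟩ := CStarAlgebra.nonneg_iff_eq_star_mul_self.mp (CFC.negPart_nonneg T)
  have hN : star T⁻ = T⁻ := (CFC.negPart_nonneg T).isSelfAdjoint
  refine ⟨T⁻, r * T⁻, hN, ?_, fun hS ↦ ?_⟩
  · have hS : star (r * T⁻) * (r * T⁻) = T⁻ * T⁻ * T⁻ := by
      rw [star_mul, hN, mul_assoc, ← mul_assoc (star r), ← hr, mul_assoc]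
    rw [hS]
    nth_rw 2 [← CFC.posPart_sub_negPart T hT]
    rw [mul_sub, CFC.negPart_mul_posPart, zero_sub, neg_mul]
  · have hN0 : T⁻ = 0 := by
      rw [← CStarRing.star_mul_self_eq_zero_iff, hN]
      nth_rw 1 [hr]
      rw [mul_assoc, hS, mul_zero]
    exact CStarAlgebra.nonneg_iff_eq_star_mul_self.mp
      (CStarAlgebra.nonneg_iff_isSelfAdjoint_and_negPart_eq_zero.mpr ⟨hT, hN0⟩)

/-- A self-adjoint matrix `T` over a C⋆-algebra is of the form `b⋆ b` as soon as `a⋆ T a` is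
positive for every column `a`. -/
theorem CStarMatrix.exists_eq_star_mul_self_of_forall_sum_nonneg {A n : Type*}
    [NonUnitalCStarAlgebra A] [PartialOrder A] [StarOrderedRing A] [Fintype n]
    {T : CStarMatrix n n A} (hT : IsSelfAdjoint T)
    (h : ∀ a : n → A, 0 ≤ ∑ i, ∑ k, star (a i) * T i k * a k) : ∃ b, T = star b * b := by
  obtain ⟨N, S, hN, hNTN, hS⟩ := hT.exists_conjugate_eq_neg_star_mul_self
  refine hS ?_
  ext k j
  have h₁ := h fun i ↦ N i j
  have h₂ : ∑ i, ∑ k, star (N i j) * T i k * N k j = (N * T * N) j j := by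
    simp only [CStarMatrix.mul_apply, Finset.sum_mul, ← CStarMatrix.star_apply, hN]
    rw [Finset.sum_comm]
  have h₃ : (star S * S) j j = ∑ k, star (S k j) * S k j := by
    rw [CStarMatrix.mul_apply]
    simp only [CStarMatrix.star_apply]
  rw [h₂, hNTN, CStarMatrix.neg_apply, h₃, Left.nonneg_neg_iff] at h₁
  have h₄ : ∀ k ∈ Finset.univ, 0 ≤ star (S k j) * S k j := fun k _ ↦ star_mul_self_nonneg _
  have h₅ := (Finset.sum_eq_zero_iff_of_nonneg h₄).mp
    (le_antisymm h₁ (Finset.sum_nonneg h₄)) k (Finset.mem_univ k)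
  exact (CStarRing.star_mul_self_eq_zero_iff _).mp h₅

namespace HilbertCStarModule

variable {A : Type*} [NonUnitalCStarAlgebra A] {E : Type*} [NormedAddCommGroup E] [Module ℂ E]
  (M : HilbertCStarModule A E)

theorem innerA_sum_right {ι : Type*} (s : Finset ι) (x : E) (y : ι → E) :
    M.innerA x (∑ i ∈ s, y i) = ∑ i ∈ s, M.innerA x (y i) :=
  map_sum (AddMonoidHom.mk' (M.innerA x) (M.innerA_add_right x)) y s

theorem innerA_sum_left {ι : Type*} (s : Finset ι) (x : ι → E) (y : E) :
    M.innerA (∑ i ∈ s, x i) y = ∑ i ∈ s, M.innerA (x i) y := by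
  rw [← M.innerA_star, innerA_sum_right, star_sum]
  simp only [M.innerA_star]

theorem innerA_smulA_left (x y : E) (a : A) :
    M.innerA (M.smulA x a) y = star a * M.innerA x y := by
  rw [← M.innerA_star, M.innerA_smulA_right, star_mul, M.innerA_star]

/-- The Gram matrix of a finite family in a Hilbert C⋆-module factors as `S⋆ S`. -/
theorem exists_gram_eq_star_mul_self {ι : Type*} [Fintype ι] (ξ : ι → E) :
    ∃ S : ι → ι → A, ∀ i k, M.innerA (ξ i) (ξ k) = ∑ l, star (S l i) * S l k := by
  let _ : PartialOrder A := CStarAlgebra.spectralOrder A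
  have _ : StarOrderedRing A := CStarAlgebra.spectralOrderedRing A
  let G : CStarMatrix ι ι A := CStarMatrix.ofMatrix fun i k ↦ M.innerA (ξ i) (ξ k)
  have hG (i k : ι) : G i k = M.innerA (ξ i) (ξ k) := rfl
  have hsa : IsSelfAdjoint G := by
    ext i k
    rw [CStarMatrix.star_apply, hG, hG, M.innerA_star]
  obtain ⟨S, hS⟩ : ∃ S, G = star S * S := by
    refine CStarMatrix.exists_eq_star_mul_self_of_forall_sum_nonneg hsa fun a ↦ ?_
    obtain ⟨b, hb⟩ := M.innerA_self_nonneg (∑ i, M.smulA (ξ i) (a i))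
    have hsum : ∑ i, ∑ k, star (a i) * G i k * a k = star b * b := by
      rw [← hb, innerA_sum_left]
      simp only [innerA_sum_right, innerA_smulA_left, M.innerA_smulA_right, hG, mul_assoc]
    exact hsum ▸ star_mul_self_nonneg b
  refine ⟨fun l i ↦ S l i, fun i k ↦ ?_⟩
  rw [← hG, hS, CStarMatrix.mul_apply]
  simp only [CStarMatrix.star_apply]

theorem sum_inner_map_innerA_nonneg {h : Type*} [NormedAddCommGroup h] [InnerProductSpace ℂ h]
    [CompleteSpace h] (π : A →⋆ₙₐ[ℂ] (h →L[ℂ] h)) {ι : Type*} [Fintype ι]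
    (ξ : ι → E) (w : ι → h) :
    0 ≤ ∑ i, ∑ k, ⟪w i, π (M.innerA (ξ i) (ξ k)) (w k)⟫_ℂ := by
  obtain ⟨S, hS⟩ := M.exists_gram_eq_star_mul_self ξ
  have hsum : ∑ i, ∑ k, ⟪w i, π (M.innerA (ξ i) (ξ k)) (w k)⟫_ℂ =
      ∑ l, ⟪∑ i, π (S l i) (w i), ∑ k, π (S l k) (w k)⟫_ℂ := by
    have hterm (i k : ι) : ⟪w i, π (M.innerA (ξ i) (ξ k)) (w k)⟫_ℂ =
        ∑ l, ⟪π (S l i) (w i), π (S l k) (w k)⟫_ℂ := by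
      simp only [hS, map_sum, map_mul, map_star, sum_apply, inner_sum,
        ContinuousLinearMap.star_eq_adjoint, mul_apply_eq_comp,
        ContinuousLinearMap.adjoint_inner_right]
    simp only [hterm, sum_inner]
    simp only [inner_sum]
    exact Finset.sum_comm_cycle
  rw [hsum]
  refine Finset.sum_nonneg fun l _ ↦ ?_
  rw [inner_self_eq_norm_sq_to_K]
  positivity

end HilbertCStarModule

/-- Let `A` be a C*-algebra, `E` a right Hilbert C*-module over `A` and `π : A → B(h)` a
*-representation on a Hilbert space `h`.  Then `Σ_{i,j} ⟨w_i, π(⟨ξ_i, ξ_j⟩) w_j⟩ ≥ 0` for all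
`ξ_1,...,ξ_n ∈ E`, `w_1,...,w_n ∈ h`; consequently the sesquilinear form on the free vector
space on the symbols `(ξ,w)` determined by `⟨(ξ,w),(ξ',w')⟩ = ⟨w, π(⟨ξ,ξ'⟩) w'⟩` is a positive
semidefinite (hermitian) semi-inner product. -/
theorem stmt_8 {A : Type*} [NonUnitalCStarAlgebra A]
    {E : Type*} [NormedAddCommGroup E] [Module ℂ E] [CompleteSpace E]
    (M : HilbertCStarModule A E)
    {h : Type*} [NormedAddCommGroup h] [InnerProductSpace ℂ h] [CompleteSpace h]
    (π : A →⋆ₙₐ[ℂ] (h →L[ℂ] h)) :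
    -- the finite sums are nonnegative real numbers:
    (∀ (n : ℕ) (ξ : Fin n → E) (w : Fin n → h),
      0 ≤ ∑ i : Fin n, ∑ k : Fin n, ⟪w i, π (M.innerA (ξ i) (ξ k)) (w k)⟫_ℂ) ∧
    -- the form is hermitian on the symbols `(ξ, w)`:
    (∀ p q : E × h,
      ⟪p.2, π (M.innerA p.1 q.1) q.2⟫_ℂ = starRingEnd ℂ ⟪q.2, π (M.innerA q.1 p.1) p.2⟫_ℂ) ∧
    -- and its sesquilinear extension to the free vector space `(E × h) →₀ ℂ` is
    -- positive semidefinite: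
    (∀ f : (E × h) →₀ ℂ,
      0 ≤ ∑ p ∈ f.support, ∑ q ∈ f.support,
        starRingEnd ℂ (f p) * f q * ⟪p.2, π (M.innerA p.1 q.1) q.2⟫_ℂ) := by
  refine ⟨fun n ξ w ↦ M.sum_inner_map_innerA_nonneg π ξ w, fun p q ↦ ?_, fun f ↦ ?_⟩
  · rw [inner_conj_symm, ← M.innerA_star q.1 p.1, map_star, ContinuousLinearMap.star_eq_adjoint,
      ContinuousLinearMap.adjoint_inner_right]
  · have := M.sum_inner_map_innerA_nonneg π (fun p : f.support ↦ p.1.1) fun p ↦ f p • p.1.2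
    simp only [map_smul, inner_smul_left, inner_smul_right] at this
    rw [← Finset.sum_coe_sort]
    simp only [← Finset.sum_coe_sort f.support]
    simpa only [mul_assoc, mul_left_comm] using this
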